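/- arXiv:1307.1978 — 2 statements merged into one kernel-verified Lean document; each statement's English description precedes it below -/
import Mathlib

section
/- If (φ₀,φ₁) ≢ 0, then the set B is nonempty; equivalently, there exists (σ,θ) ∈ (−∞,M)×[0,2π] with F₁(σ,θ) ≠ 0, F₂(σ,θ) > 0 and F₁(σ,θ) + F₂(σ,θ) > 0. -/
open Real MeasureTheory Filter Topology Asymptotics

noncomputable section

/-- Partial derivative in the `i`-th coordinate direction on `Fin 3 → ℝ`
(coordinates `y = (t, x₁, x₂)`). -/
def pd (i : Fin 3) (f : (Fin 3 → ℝ) → ℝ) : (Fin 3 → ℝ) → ℝ :=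
  fun y => fderiv ℝ f y (Pi.single i 1)

/-- Radon transform of `v : ℝ² → ℝ` over the line `x · ω = s`, where
`ω = (cos θ, sin θ)`. -/
def radon (v : ℝ × ℝ → ℝ) (s θ : ℝ) : ℝ :=
  ∫ t : ℝ, v (s * Real.cos θ - t * Real.sin θ, s * Real.sin θ + t * Real.cos θ)

/-- `ω̂ = (-1, cos θ, sin θ)`. -/
def omegaHat (θ : ℝ) : Fin 3 → ℝ := ![(-1 : ℝ), Real.cos θ, Real.sin θ]

/-- The Friedlander radiation field `F₀` associated with the data `(φ₀, φ₁)`. -/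
def F0 (φ0 φ1 : ℝ × ℝ → ℝ) (σ θ : ℝ) : ℝ :=
  (1 / (2 * Real.pi * Real.sqrt 2)) *
    ∫ s in Set.Ioi σ,
      (radon φ1 s θ - deriv (fun s' => radon φ0 s' θ) s) / Real.sqrt (s - σ)

/-- `F₁(σ,θ) = (Σ d_ij ω̂_i ω̂_j) ∂_σ F₀(σ,θ)`. -/
def F1 (d : Fin 3 → Fin 3 → ℝ) (φ0 φ1 : ℝ × ℝ → ℝ) (σ θ : ℝ) : ℝ :=
  (∑ i : Fin 3, ∑ j : Fin 3, d i j * omegaHat θ i * omegaHat θ j) *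
    deriv (fun σ' => F0 φ0 φ1 σ' θ) σ

/-- `F₂(σ,θ) = (Σ e_ij^k ω̂_i ω̂_j ω̂_k) ∂²_σ F₀(σ,θ)`. -/
def F2 (e : Fin 3 → Fin 3 → Fin 3 → ℝ) (φ0 φ1 : ℝ × ℝ → ℝ) (σ θ : ℝ) : ℝ :=
  (∑ i : Fin 3, ∑ j : Fin 3, ∑ k : Fin 3,
      e i j k * omegaHat θ i * omegaHat θ j * omegaHat θ k) *
    deriv (fun σ' => deriv (fun σ'' => F0 φ0 φ1 σ'' θ) σ') σ

/-- `G₀(σ,θ) = (1/F₁) log(1 + F₁/F₂)`. -/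
def G0 (d : Fin 3 → Fin 3 → ℝ) (e : Fin 3 → Fin 3 → Fin 3 → ℝ)
    (φ0 φ1 : ℝ × ℝ → ℝ) (σ θ : ℝ) : ℝ :=
  (1 / F1 d φ0 φ1 σ θ) * Real.log (1 + F1 d φ0 φ1 σ θ / F2 e φ0 φ1 σ θ)

/-- The set `A`. -/
def setA (M : ℝ) (d : Fin 3 → Fin 3 → ℝ) (e : Fin 3 → Fin 3 → Fin 3 → ℝ)
    (φ0 φ1 : ℝ × ℝ → ℝ) : Set (ℝ × ℝ) :=
  {p | p.1 < M ∧ p.2 ∈ Set.Icc 0 (2 * Real.pi) ∧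
    F1 d φ0 φ1 p.1 p.2 ≠ 0 ∧ F2 e φ0 φ1 p.1 p.2 ≠ 0 ∧
    0 < 1 + F1 d φ0 φ1 p.1 p.2 / F2 e φ0 φ1 p.1 p.2}

/-- The set `B = {(σ,θ) ∈ A : G₀(σ,θ) > 0}`. -/
def setB (M : ℝ) (d : Fin 3 → Fin 3 → ℝ) (e : Fin 3 → Fin 3 → Fin 3 → ℝ)
    (φ0 φ1 : ℝ × ℝ → ℝ) : Set (ℝ × ℝ) :=
  {p ∈ setA M d e φ0 φ1 | 0 < G0 d e φ0 φ1 p.1 p.2}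

/-- `τ₀ = inf_{(σ,θ) ∈ B} G₀(σ,θ)`. -/
def tau0 (M : ℝ) (d : Fin 3 → Fin 3 → ℝ) (e : Fin 3 → Fin 3 → Fin 3 → ℝ)
    (φ0 φ1 : ℝ × ℝ → ℝ) : ℝ :=
  sInf ((fun p : ℝ × ℝ => G0 d e φ0 φ1 p.1 p.2) '' setB M d e φ0 φ1)

/-- The set `D = {(σ,θ) : σ < M, F₁ = 0, F₂ > 0}`. -/
def setD (M : ℝ) (d : Fin 3 → Fin 3 → ℝ) (e : Fin 3 → Fin 3 → Fin 3 → ℝ)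
    (φ0 φ1 : ℝ × ℝ → ℝ) : Set (ℝ × ℝ) :=
  {p | p.1 < M ∧ p.2 ∈ Set.Icc 0 (2 * Real.pi) ∧
    F1 d φ0 φ1 p.1 p.2 = 0 ∧ 0 < F2 e φ0 φ1 p.1 p.2}

/-- `φ` is supported in the closed disk of radius `M` centered at the origin. -/
def SuppIn (M : ℝ) (φ : ℝ × ℝ → ℝ) : Prop :=
  ∀ x : ℝ × ℝ, M ^ 2 < x.1 ^ 2 + x.2 ^ 2 → φ x = 0

/-- The cubic form `Σ e_ij^k ξ_i ξ_j ξ_k` does not satisfy the null condition: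
it does not vanish identically on the light cone. -/
def NullCondFails (e : Fin 3 → Fin 3 → Fin 3 → ℝ) : Prop :=
  ∃ ξ : Fin 3 → ℝ, ξ 0 ^ 2 = ξ 1 ^ 2 + ξ 2 ^ 2 ∧ (ξ 1 ≠ 0 ∨ ξ 2 ≠ 0) ∧
    (∑ i : Fin 3, ∑ j : Fin 3, ∑ k : Fin 3, e i j k * ξ i * ξ j * ξ k) ≠ 0

/-- Hessian (as a 2×2 matrix) of a function of two real variables. -/
def hessCurried (f : ℝ → ℝ → ℝ) (σ θ : ℝ) : Matrix (Fin 2) (Fin 2) ℝ :=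
  !![deriv (fun a => deriv (fun b => f b θ) a) σ,
     deriv (fun a => deriv (fun b => f a b) θ) σ;
     deriv (fun b => deriv (fun a => f a b) σ) θ,
     deriv (fun b => deriv (fun b' => f σ b') b) θ]

/-- Minkowski coefficients: `Σ c_ij ∂_ij = ∂_t² - Δ`. -/
def cMink : Fin 3 → Fin 3 → ℝ := fun i j =>
  if i = j then (if i = 0 then 1 else -1) else 0

/-- `u` is a `C^∞` solution of problem (1.1) on `[0,T) × ℝ²`. -/
def IsSol (g : Fin 3 → Fin 3 → ℝ → (Fin 3 → ℝ) → ℝ) (ε : ℝ)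
    (φ0 φ1 : ℝ × ℝ → ℝ) (u : (Fin 3 → ℝ) → ℝ) (T : ℝ) : Prop :=
  ContDiffOn ℝ (⊤ : ℕ∞) u {y | 0 ≤ y 0 ∧ y 0 < T} ∧
  (∀ y : Fin 3 → ℝ, 0 ≤ y 0 → y 0 < T →
    ∑ i : Fin 3, ∑ j : Fin 3,
      g i j (u y) (fun k => pd k u y) * pd i (pd j u) y = 0) ∧
  (∀ x : ℝ × ℝ, u ![0, x.1, x.2] = ε * φ0 x ∧ pd 0 u ![0, x.1, x.2] = ε * φ1 x)

/-- The lifespan `T_ε`: the supremum of times of existence of smooth solutions. -/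
def lifespan (g : Fin 3 → Fin 3 → ℝ → (Fin 3 → ℝ) → ℝ) (ε : ℝ)
    (φ0 φ1 : ℝ × ℝ → ℝ) : ℝ :=
  sSup {T : ℝ | ∃ u, IsSol g ε φ0 φ1 u T}

/-- `V` is a `C^∞` solution of the profile problem (2.1) on `ℝ × S¹ × [0, τmax)`. -/
def IsProfileSol (M : ℝ) (d : Fin 3 → Fin 3 → ℝ) (e : Fin 3 → Fin 3 → Fin 3 → ℝ)
    (φ0 φ1 : ℝ × ℝ → ℝ) (τmax : ℝ) (V : ℝ → ℝ → ℝ → ℝ) : Prop :=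
  ContDiffOn ℝ (⊤ : ℕ∞) (fun p : ℝ × ℝ × ℝ => V p.1 p.2.1 p.2.2)
    {p : ℝ × ℝ × ℝ | 0 ≤ p.2.2 ∧ p.2.2 < τmax} ∧
  (∀ q θ τ : ℝ, V q (θ + 2 * Real.pi) τ = V q θ τ) ∧
  (∀ q θ τ : ℝ, M < q → V q θ τ = 0) ∧
  (∀ q θ : ℝ, V q θ 0 = F0 φ0 φ1 q θ) ∧
  (∀ q θ τ : ℝ, 0 ≤ τ → τ < τmax →
    deriv (fun τ' => deriv (fun q' => V q' θ τ') q) τ -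
      ∑ i : Fin 3, ∑ j : Fin 3,
        (d i j * V q θ τ +
          ∑ k : Fin 3, e i j k * omegaHat θ k * deriv (fun q' => V q' θ τ) q) *
        omegaHat θ i * omegaHat θ j *
        deriv (fun q' => deriv (fun q'' => V q'' θ τ) q') q = 0)

/-- The Jacobian `∂_s q` of the characteristic flow. -/
def kfun (d : Fin 3 → Fin 3 → ℝ) (e : Fin 3 → Fin 3 → Fin 3 → ℝ)
    (φ0 φ1 : ℝ × ℝ → ℝ) (ρ θ τ : ℝ) : ℝ :=
  if F1 d φ0 φ1 ρ θ = 0 then 1 - τ * F2 e φ0 φ1 ρ θ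
  else Real.exp (-τ * F1 d φ0 φ1 ρ θ) * (1 + F2 e φ0 φ1 ρ θ / F1 d φ0 φ1 ρ θ)
        - F2 e φ0 φ1 ρ θ / F1 d φ0 φ1 ρ θ

/-- Partial derivatives on `ℝ × ℝ × ℝ` (coordinates `(s, θ, τ)`). -/
def pd3 : Fin 3 → (ℝ × ℝ × ℝ → ℝ) → ℝ × ℝ × ℝ → ℝ :=
  ![fun f p => deriv (fun a => f (a, p.2.1, p.2.2)) p.1,
    fun f p => deriv (fun a => f (p.1, a, p.2.2)) p.2.1,
    fun f p => deriv (fun a => f (p.1, p.2.1, a)) p.2.2]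

/-- Hessian in the first two variables `(s, θ)` of a function on `ℝ × ℝ × ℝ`. -/
def hessST (f : ℝ × ℝ × ℝ → ℝ) (p : ℝ × ℝ × ℝ) : Matrix (Fin 2) (Fin 2) ℝ :=
  !![pd3 0 (pd3 0 f) p, pd3 0 (pd3 1 f) p;
     pd3 1 (pd3 0 f) p, pd3 1 (pd3 1 f) p]

/-- The Klainerman vector fields on `ℝ_t × ℝ²`:
`∂_t, ∂_1, ∂_2, S = t∂_t + x₁∂_1 + x₂∂_2, H₁, H₂, R`. -/
def KOp : Fin 7 → ((Fin 3 → ℝ) → ℝ) → (Fin 3 → ℝ) → ℝ :=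
  ![fun f => pd 0 f,
    fun f => pd 1 f,
    fun f => pd 2 f,
    fun f y => y 0 * pd 0 f y + y 1 * pd 1 f y + y 2 * pd 2 f y,
    fun f y => y 1 * pd 0 f y + y 0 * pd 1 f y,
    fun f y => y 2 * pd 0 f y + y 0 * pd 2 f y,
    fun f y => y 1 * pd 2 f y - y 2 * pd 1 f y]

/-- `Z^α`: iterated product of Klainerman vector fields indexed by a list. -/
def Zpow (α : List (Fin 7)) (f : (Fin 3 → ℝ) → ℝ) : (Fin 3 → ℝ) → ℝ :=
  α.foldr (fun i acc => KOp i acc) f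

end

/-- Elementary: between a point below level `c` and a later point above level `c`
there is a point above `c` with positive derivative. -/
lemma exists_gt_deriv_pos {u : ℝ → ℝ} (hu : Differentiable ℝ u) {a b c : ℝ} (hab : a < b)
    (ha : u a ≤ c) (hb : c < u b) : ∃ x ∈ Set.Ioo a b, c < u x ∧ 0 < deriv u x := by
  have hcomp : IsCompact (Set.Icc a b ∩ {x | u x ≤ c}) :=
    isCompact_Icc.inter_right (isClosed_le hu.continuous continuous_const)
  obtain ⟨m, ⟨⟨hm1, hm2⟩, hmc⟩, hmax⟩ :=
    hcomp.exists_isGreatest ⟨a, ⟨le_refl a, hab.le⟩, ha⟩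
  have hmc' : u m ≤ c := hmc
  have hmb : m < b := lt_of_le_of_ne hm2 (by rintro rfl; linarith)
  obtain ⟨x, hx, hxd⟩ := exists_deriv_eq_slope u hmb hu.continuous.continuousOn
    hu.differentiableOn
  refine ⟨x, ⟨by linarith [hx.1], hx.2⟩, ?_, ?_⟩
  · by_contra hcon
    have := hmax ⟨⟨by linarith [hx.1], hx.2.le⟩, not_lt.mp hcon⟩
    linarith [hx.1]
  · rw [hxd]
    exact div_pos (by linarith) (by linarith)

lemma exists_lt_deriv_pos {u : ℝ → ℝ} (hu : Differentiable ℝ u) {a b c : ℝ} (hab : a < b)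
    (ha : u a < c) (hb : c ≤ u b) : ∃ x ∈ Set.Ioo a b, u x < c ∧ 0 < deriv u x := by
  have hv : Differentiable ℝ (fun x => - u (-x)) := (hu.comp differentiable_neg).neg
  obtain ⟨x, hx, h1, h2⟩ := exists_gt_deriv_pos (u := fun x => - u (-x)) hv
    (a := -b) (b := -a) (c := -c) (by linarith) (by simpa using hb) (by simpa using ha)
  refine ⟨-x, ⟨by linarith [hx.2], by linarith [hx.1]⟩, by linarith, ?_⟩
  have : deriv (fun x => - u (-x)) x = deriv u (-x) := by
    rw [deriv.fun_neg, deriv_comp_neg]; simp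
  rwa [this] at h2

/-- The one-dimensional core of the argument. -/
lemma core_one_dim {f : ℝ → ℝ} (hf : ContDiff ℝ 2 f) {M : ℝ} (hM : ∀ x, M ≤ x → f x = 0)
    (hlim : Tendsto f atBot (𝓝 0)) (hne : ∃ x, f x ≠ 0) {a b : ℝ} (ha : a ≠ 0) (hb : b ≠ 0) :
    ∃ x < M, a * deriv f x ≠ 0 ∧ 0 < b * deriv (deriv f) x ∧
      0 < a * deriv f x + b * deriv (deriv f) x := by
  -- normalise `b = 1`
  suffices H : ∀ g : ℝ → ℝ, ContDiff ℝ 2 g → (∀ x, M ≤ x → g x = 0) → Tendsto g atBot (𝓝 0) →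
      (∃ x, g x ≠ 0) → ∀ k : ℝ, k ≠ 0 → ∃ x < M, deriv g x ≠ 0 ∧ 0 < deriv (deriv g) x ∧
      0 < k * deriv g x + deriv (deriv g) x by
    obtain ⟨x, hx, h1, h2, h3⟩ := H (fun x => b * f x) (contDiff_const.mul hf)
      (fun x hx => by simp [hM x hx]) (by simpa using hlim.const_mul b)
      (hne.imp fun x hx => mul_ne_zero hb hx) (a / b) (div_ne_zero ha hb)
    have e1 : deriv (fun x => b * f x) = fun x => b * deriv f x := by
      funext y; exact deriv_const_mul_field b
    have e2 : deriv (deriv (fun x => b * f x)) x = b * deriv (deriv f) x := by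
      rw [e1]; exact deriv_const_mul_field b
    rw [e2] at h2 h3
    rw [e1] at h1 h3
    refine ⟨x, hx, mul_ne_zero ha (right_ne_zero_of_mul h1), h2, ?_⟩
    have : a / b * (b * deriv f x) = a * deriv f x := by field_simp
    simpa [this] using h3
  clear hne hlim hM hf f
  intro f hf hM hlim hne k hk
  have hfd : Differentiable ℝ f := hf.differentiable (by norm_num)
  have hud : Differentiable ℝ (deriv f) :=
    (contDiff_succ_iff_deriv (n := 1).1 hf).2.2.differentiable (by norm_num)
  -- both signs of the derivative occur
  have key : (∃ x < M, 0 < deriv f x) ∧ (∃ x < M, deriv f x < 0) := by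
    obtain ⟨x0, hx0⟩ := hne
    have hx0M : x0 < M := by
      by_contra h
      exact hx0 (hM x0 (not_lt.mp h))
    have hfM : f M = 0 := hM M le_rfl
    rcases lt_or_gt_of_ne hx0 with h | h
    · have hev : ∀ᶠ y in atBot, f x0 < f y := hlim.eventually (lt_mem_nhds h)
      obtain ⟨y, hy1, hy2⟩ := (hev.and (eventually_lt_atBot x0)).exists
      constructor
      · obtain ⟨z, hz, hzd⟩ := exists_deriv_eq_slope f hx0M hfd.continuous.continuousOn
          hfd.differentiableOn
        exact ⟨z, hz.2, by rw [hzd]; exact div_pos (by linarith) (by linarith)⟩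
      · obtain ⟨z, hz, hzd⟩ := exists_deriv_eq_slope f hy2 hfd.continuous.continuousOn
          hfd.differentiableOn
        exact ⟨z, by linarith [hz.2], by
          rw [hzd]; exact div_neg_of_neg_of_pos (by linarith) (by linarith)⟩
    · have hev : ∀ᶠ y in atBot, f y < f x0 := hlim.eventually (gt_mem_nhds h)
      obtain ⟨y, hy1, hy2⟩ := (hev.and (eventually_lt_atBot x0)).exists
      constructor
      · obtain ⟨z, hz, hzd⟩ := exists_deriv_eq_slope f hy2 hfd.continuous.continuousOn
          hfd.differentiableOn
        exact ⟨z, by linarith [hz.2], by rw [hzd]; exact div_pos (by linarith) (by linarith)⟩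
      · obtain ⟨z, hz, hzd⟩ := exists_deriv_eq_slope f hx0M hfd.continuous.continuousOn
          hfd.differentiableOn
        exact ⟨z, hz.2, by
          rw [hzd]; exact div_neg_of_neg_of_pos (by linarith) (by linarith)⟩
  obtain ⟨⟨p, hpM, hp⟩, ⟨q, hqM, hq⟩⟩ := key
  rcases lt_or_gt_of_ne hk with hk | hk
  · -- `k < 0`: use a point where `f' < 0`, `f'' > 0`, to the left of `M + 1`
    have huM : deriv f M = 0 := by
      have h1 : HasDerivWithinAt f (deriv f M) (Set.Ici M) M :=
        (hfd M).hasDerivAt.hasDerivWithinAt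
      have h2 : HasDerivWithinAt f 0 (Set.Ici M) M :=
        (hasDerivWithinAt_const M (Set.Ici M) (0 : ℝ)).congr (fun x hx => hM x hx) (hM M le_rfl)
      exact (uniqueDiffWithinAt_Ici M).eq_deriv _ h1 h2
    obtain ⟨x, hx, h1, h2⟩ := exists_lt_deriv_pos hud hqM hq huM.ge
    exact ⟨x, hx.2, h1.ne, h2, by nlinarith⟩
  · -- `k > 0`: use a point where `f' > 0`, `f'' > 0`
    have hex : ∃ y < p, deriv f y ≤ deriv f p / 2 := by
      have hsh : Tendsto (fun y => f (y + 1)) atBot (𝓝 0) :=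
        hlim.comp (tendsto_atBot_add_const_right _ 1 tendsto_id)
      have hdiff : Tendsto (fun y => f (y + 1) - f y) atBot (𝓝 0) := by
        simpa using hsh.sub hlim
      have hev : ∀ᶠ y in atBot, f (y + 1) - f y < deriv f p / 2 :=
        hdiff.eventually (gt_mem_nhds (by linarith))
      obtain ⟨y, hy1, hy2⟩ := (hev.and (eventually_lt_atBot (p - 1))).exists
      obtain ⟨z, hz, hzd⟩ := exists_deriv_eq_slope f (show y < y + 1 by linarith)
        hfd.continuous.continuousOn hfd.differentiableOn
      refine ⟨z, by linarith [hz.2], ?_⟩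
      rw [hzd]; simp; linarith
    obtain ⟨y, hyp, hy⟩ := hex
    obtain ⟨x, hx, h1, h2⟩ := exists_gt_deriv_pos hud hyp hy (by linarith)
    have h3 : 0 < deriv f x := by linarith
    exact ⟨x, by linarith [hx.2], h3.ne', h2, by positivity⟩

/-- Uniqueness via Stone-Weierstrass. -/
lemma eq_zero_of_integral_submonoid {E : Type*} [TopologicalSpace E] [T2Space E]
    [MeasurableSpace E] [BorelSpace E] (μ : Measure E) [IsFiniteMeasureOnCompacts μ]
    [μ.IsOpenPosMeasure]
    {φ : E → ℝ} (hφ : Continuous φ) (hc : HasCompactSupport φ)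
    (S : Submonoid C(E, ℝ)) (hsep : ∀ x y : E, x ≠ y → ∃ χ ∈ S, χ x ≠ χ y)
    (hS : ∀ χ ∈ S, ∫ x, φ x * χ x ∂μ = 0) : φ = 0 := by
  have hint : ∀ χ : C(E, ℝ), Integrable (fun x => φ x * χ x) μ := fun χ =>
    (hφ.mul χ.continuous).integrable_of_hasCompactSupport (hc.mul_right)
  have hA : ∀ χ ∈ Algebra.adjoin ℝ (S : Set C(E, ℝ)), ∫ x, φ x * χ x ∂μ = 0 := by
    intro χ hχ
    rw [← Subalgebra.mem_toSubmodule, Algebra.adjoin_eq_span_of_subset] at hχ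
    · induction hχ using Submodule.span_induction with
      | mem x hx => exact hS x hx
      | zero => simp
      | add x y _ _ hx hy =>
        have : ∀ z, φ z * (x + y) z = φ z * x z + φ z * y z := fun z => by simp [mul_add]
        simp_rw [this]
        rw [integral_add (hint x) (hint y), hx, hy, add_zero]
      | smul a x _ hx =>
        have : ∀ z, φ z * (a • x) z = a * (φ z * x z) := fun z => by
          simp; ring
        simp_rw [this]
        rw [integral_const_mul, hx, mul_zero]
    · rw [Submonoid.closure_eq]; exact Submodule.subset_span
  have hsepA : (Algebra.adjoin ℝ (S : Set C(E, ℝ))).SeparatesPoints := by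
    intro x y hxy
    obtain ⟨χ, h1, h2⟩ := hsep x y hxy
    exact ⟨χ, ⟨χ, Algebra.subset_adjoin h1, rfl⟩, h2⟩
  by_contra hne
  obtain ⟨x0, hx0⟩ := Function.ne_iff.mp hne
  have hpos : 0 < ∫ x, φ x * φ x ∂μ :=
    (hφ.mul hφ).integral_pos_of_hasCompactSupport_nonneg_nonzero hc.mul_right
      (fun x => mul_self_nonneg _) (mul_ne_zero hx0 hx0)
  set I := ∫ x, φ x * φ x ∂μ
  set J := ∫ x, |φ x| ∂μ
  have hJ : 0 ≤ J := integral_nonneg fun x => abs_nonneg _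
  obtain ⟨g, hgA, hg⟩ :=
    ContinuousMap.exists_mem_subalgebra_near_continuous_of_isCompact_of_separatesPoints hsepA
      ⟨φ, hφ⟩ hc (ε := I / (2 * (J + 1))) (by positivity)
  have h0 := hA g hgA
  have habs : Integrable (fun x => |φ x|) μ :=
    (hφ.integrable_of_hasCompactSupport hc).abs
  have hint2 : Integrable (fun x => φ x * φ x) μ := hint ⟨φ, hφ⟩
  have hI : I = ∫ x, (φ x * φ x - φ x * g x) ∂μ := by
    rw [integral_sub hint2 (hint g), h0, sub_zero]
  have hle : I ≤ ∫ x, (I / (2 * (J + 1))) * |φ x| ∂μ := by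
    conv_lhs => rw [hI]
    refine integral_mono (hint2.sub (hint g)) (habs.const_mul _) ?_
    intro x
    by_cases hx : x ∈ tsupport φ
    · have := hg x hx
      rw [Real.norm_eq_abs] at this
      have h2 : φ x * φ x - φ x * g x ≤ |φ x| * |g x - φ x| := by
        rw [← abs_mul]
        refine le_trans ?_ (neg_le_abs _)
        linarith
      refine h2.trans ?_
      rw [mul_comm]
      exact mul_le_mul_of_nonneg_right this.le (abs_nonneg _)
    · have : φ x = 0 := image_eq_zero_of_notMem_tsupport hx
      simp [this]
  rw [integral_const_mul] at hle
  have : I / (2 * (J + 1)) * J < I := by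
    rw [div_mul_eq_mul_div, div_lt_iff₀ (by positivity)]
    nlinarith
  linarith

/-- The Abel kernel (it vanishes for `t ≥ 0` by the conventions `√x = 0` for `x ≤ 0`). -/
noncomputable def abelKer (t : ℝ) : ℝ := 1 / Real.sqrt (-t)

lemma abelKer_zero {t : ℝ} (ht : 0 ≤ t) : abelKer t = 0 := by
  unfold abelKer
  rw [Real.sqrt_eq_zero_of_nonpos (by linarith)]; simp

lemma abelKer_laplace {r : ℝ} (hr : 0 < r) :
    ∫ t, abelKer t * Real.exp (r * t) = (1 / r) ^ (1 / 2 : ℝ) * Real.Gamma (1 / 2) := by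
  rw [← Real.integral_rpow_mul_exp_neg_mul_Ioi (by norm_num : (0 : ℝ) < 1 / 2) hr]
  rw [← integral_neg_eq_self, ← integral_indicator measurableSet_Ioi]
  congr 1
  funext t
  by_cases ht : 0 < t
  · rw [Set.indicator_of_mem (by exact ht)]
    unfold abelKer
    rw [neg_neg, Real.sqrt_eq_rpow, one_div, ← Real.rpow_neg ht.le]
    norm_num
  · rw [Set.indicator_of_notMem (by simpa using ht), abelKer_zero (by linarith), zero_mul]

lemma abelKer_integrable {r : ℝ} (hr : 0 < r) :
    Integrable (fun t => abelKer t * Real.exp (r * t)) := by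
  refine .of_integral_ne_zero ?_
  rw [abelKer_laplace hr]
  have := Real.Gamma_pos_of_pos (by norm_num : (0 : ℝ) < 1 / 2)
  positivity

lemma abelKer_locallyIntegrable : LocallyIntegrable abelKer := by
  rw [locallyIntegrable_iff]
  intro k hk
  have h1 : IntegrableOn (fun t => abelKer t * Real.exp (1 * t)) k :=
    (abelKer_integrable one_pos).integrableOn
  have h2 := h1.mul_continuousOn (g' := fun t => Real.exp (-(1 * t)))
    (by fun_prop) hk
  refine h2.congr_fun ?_ hk.measurableSet
  intro t _
  simp only
  rw [mul_assoc, ← Real.exp_add]; simp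

/-- The Abel transform. -/
noncomputable def abelT (g : ℝ → ℝ) (σ : ℝ) : ℝ := ∫ s in Set.Ioi σ, g s / Real.sqrt (s - σ)

lemma abelT_eq (g : ℝ → ℝ) :
    abelT g = convolution abelKer g (ContinuousLinearMap.mul ℝ ℝ) volume := by
  funext σ
  rw [convolution_eq_swap, abelT, ← integral_indicator measurableSet_Ioi]
  congr 1
  funext s
  by_cases hs : σ < s
  · rw [Set.indicator_of_mem (by exact hs)]
    simp [abelKer, div_eq_inv_mul]
  · rw [Set.indicator_of_notMem (by simpa using hs), abelKer_zero (by linarith)]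
    simp

lemma abelT_contDiff {g : ℝ → ℝ} (hg : ContDiff ℝ (⊤ : ℕ∞) g) (hc : HasCompactSupport g) :
    ContDiff ℝ (⊤ : ℕ∞) (abelT g) := by
  rw [abelT_eq]
  exact hc.contDiff_convolution_right _ abelKer_locallyIntegrable hg

lemma abelT_zero {g : ℝ → ℝ} {M : ℝ} (hg : ∀ s, M < |s| → g s = 0) {σ : ℝ} (hσ : M ≤ σ) :
    abelT g σ = 0 := by
  unfold abelT
  refine setIntegral_eq_zero_of_forall_eq_zero fun s hs => ?_
  rw [hg s (lt_of_lt_of_le (lt_of_le_of_lt hσ hs) (le_abs_self s)), zero_div]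

lemma abelT_tendsto {g : ℝ → ℝ} {M : ℝ} (hg : ∀ s, M < |s| → g s = 0) (hi : Integrable g) :
    Tendsto (abelT g) atBot (𝓝 0) := by
  have hb : ∀ σ < -M, ‖abelT g σ‖ ≤ (∫ s, ‖g s‖) * (1 / Real.sqrt (-M - σ)) := by
    intro σ hσ
    rw [abelT_eq, convolution_eq_swap, ← integral_mul_const]
    refine norm_integral_le_of_norm_le (hi.norm.mul_const _) (ae_of_all _ fun s => ?_)
    simp only [ContinuousLinearMap.mul_apply', norm_mul]
    rw [mul_comm]
    by_cases hs : M < |s|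
    · simp [hg s hs]
    · refine mul_le_mul_of_nonneg_left ?_ (norm_nonneg _)
      have h1 := (abs_le.mp (not_lt.mp hs)).1
      unfold abelKer
      rw [Real.norm_of_nonneg (by positivity)]
      have : 0 < Real.sqrt (-M - σ) := Real.sqrt_pos.mpr (by linarith)
      exact one_div_le_one_div_of_le this (Real.sqrt_le_sqrt (by linarith))
  have hlim : Tendsto (fun σ : ℝ => (∫ s, ‖g s‖) * (1 / Real.sqrt (-M - σ))) atBot (𝓝 0) := by
    have h1 : Tendsto (fun σ : ℝ => -M - σ) atBot atTop := by
      simpa [sub_eq_add_neg] using tendsto_atTop_add_const_left _ (-M) tendsto_neg_atBot_atTop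
    have h2 := (Real.tendsto_sqrt_atTop.comp h1).inv_tendsto_atTop
    have h3 := h2.const_mul (∫ s, ‖g s‖)
    simpa [one_div] using h3
  exact squeeze_zero_norm' ((eventually_lt_atBot (-M)).mono hb) hlim

lemma abelT_laplace {g : ℝ → ℝ} (hg : Continuous g) (hc : HasCompactSupport g)
    (h0 : ∀ σ, abelT g σ = 0) {r : ℝ} (hr : 0 < r) : ∫ s, g s * Real.exp (r * s) = 0 := by
  have hgi : Integrable (fun s => g s * Real.exp (r * s)) :=
    (hg.mul (by fun_prop)).integrable_of_hasCompactSupport hc.mul_right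
  have h := integral_convolution (ContinuousLinearMap.mul ℝ ℝ) (abelKer_integrable hr) hgi
  have hz : ∀ x, convolution (fun t => abelKer t * Real.exp (r * t))
      (fun s => g s * Real.exp (r * s)) (ContinuousLinearMap.mul ℝ ℝ) volume x = 0 := by
    intro x
    have e : convolution (fun t => abelKer t * Real.exp (r * t))
      (fun s => g s * Real.exp (r * s)) (ContinuousLinearMap.mul ℝ ℝ) volume x
      = Real.exp (r * x) * abelT g x := by
      rw [abelT_eq, convolution_eq_swap, convolution_eq_swap, ← integral_const_mul]
      congr 1
      funext t
      simp only [ContinuousLinearMap.mul_apply']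
      have : Real.exp (r * x) = Real.exp (r * (x - t)) * Real.exp (r * t) := by
        rw [← Real.exp_add]; ring_nf
      rw [this]; ring
    rw [e, h0, mul_zero]
  simp_rw [hz] at h
  rw [integral_zero, abelKer_laplace hr] at h
  have hG := Real.Gamma_pos_of_pos (by norm_num : (0 : ℝ) < 1 / 2)
  have hp : 0 < (1 / r) ^ (1 / 2 : ℝ) * Real.Gamma (1 / 2) := by positivity
  rcases mul_eq_zero.mp h.symm with h' | h'
  · exact absurd h' hp.ne'
  · exact h'

/-- Exponential functions on `ℝ`. -/
noncomputable def expMap (r : ℝ) : C(ℝ, ℝ) := ⟨fun s => Real.exp (r * s), by fun_prop⟩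

lemma abelT_injective {g : ℝ → ℝ} (hg : Continuous g) (hc : HasCompactSupport g)
    (h0 : ∀ σ, abelT g σ = 0) : g = 0 := by
  let S : Submonoid C(ℝ, ℝ) :=
    { carrier := {χ | ∃ r, 0 ≤ r ∧ χ = expMap r}
      one_mem' := ⟨0, le_rfl, by ext s; simp [expMap]⟩
      mul_mem' := by
        rintro _ _ ⟨a, ha, rfl⟩ ⟨b, hb, rfl⟩
        exact ⟨a + b, add_nonneg ha hb, by ext s; simp [expMap, add_mul, Real.exp_add]⟩ }
  have h := eq_zero_of_integral_submonoid volume (φ := fun s => g s * Real.exp (1 * s))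
    (hg.mul (by fun_prop)) hc.mul_right S
    (fun x y hxy => ⟨expMap 1, ⟨1, zero_le_one, rfl⟩, by simpa [expMap] using hxy⟩)
    (by
      rintro _ ⟨r, hr, rfl⟩
      rw [← abelT_laplace hg hc h0 (show 0 < 1 + r by linarith)]
      congr 1
      funext s
      simp only [expMap, ContinuousMap.coe_mk]
      rw [mul_assoc, ← Real.exp_add, add_mul])
  funext s
  have := congrFun h s
  simpa using this

lemma SuppIn.hasCompactSupport {M : ℝ} (hM : 0 < M) {φ : ℝ × ℝ → ℝ} (h : SuppIn M φ) :
    HasCompactSupport φ := by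
  refine HasCompactSupport.intro (K := Set.Icc (-M) M ×ˢ Set.Icc (-M) M)
    (isCompact_Icc.prod isCompact_Icc) fun x hx => h x ?_
  by_contra hcon
  rw [not_lt] at hcon
  exact hx ⟨abs_le.mp (abs_le_of_sq_le_sq (by nlinarith [sq_nonneg x.2]) hM.le),
    abs_le.mp (abs_le_of_sq_le_sq (by nlinarith [sq_nonneg x.1]) hM.le)⟩

lemma rot_sq (s t θ : ℝ) : (s * Real.cos θ - t * Real.sin θ) ^ 2 +
    (s * Real.sin θ + t * Real.cos θ) ^ 2 = s ^ 2 + t ^ 2 := by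
  linear_combination (s ^ 2 + t ^ 2) * Real.cos_sq_add_sin_sq θ

lemma radon_zero {M : ℝ} (hM : 0 < M) {φ : ℝ × ℝ → ℝ} (h : SuppIn M φ) {s : ℝ} (θ : ℝ)
    (hs : M < |s|) : radon φ s θ = 0 := by
  unfold radon
  have : ∀ t, φ (s * Real.cos θ - t * Real.sin θ, s * Real.sin θ + t * Real.cos θ) = 0 := by
    intro t
    apply h
    simp only
    rw [rot_sq]
    have : M ^ 2 < s ^ 2 := by
      rw [← sq_abs s]; exact pow_lt_pow_left₀ hs hM.le two_ne_zero
    nlinarith [sq_nonneg t]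
  simp [this]

lemma radon_contDiff {M : ℝ} (hM : 0 < M) {φ : ℝ × ℝ → ℝ} (hφ : ContDiff ℝ (⊤ : ℕ∞) φ)
    (h : SuppIn M φ) (θ : ℝ) : ContDiff ℝ (⊤ : ℕ∞) (fun s => radon φ s θ) := by
  let G : ℝ → ℝ → ℝ := fun s t =>
    φ (s * Real.cos θ - (-t) * Real.sin θ, s * Real.sin θ + (-t) * Real.cos θ)
  have hG : ContDiff ℝ (⊤ : ℕ∞) (fun p : ℝ × ℝ => G p.1 p.2) := by
    refine hφ.comp ?_
    fun_prop
  have key := contDiffOn_convolution_right_with_param_comp (μ := volume)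
    (ContinuousLinearMap.mul ℝ ℝ) (n := ((⊤ : ℕ∞) : ℕ∞)) (s := Set.univ) (v := fun _ => (0 : ℝ))
    contDiffOn_const (f := fun _ : ℝ => (1 : ℝ)) (g := G) (k := Set.Icc (-M) M) isOpen_univ
    isCompact_Icc
    (by
      intro p x _ hx
      apply h
      simp only
      rw [rot_sq]
      have : M < |x| := by
        by_contra hc
        exact hx (abs_le.mp (not_lt.mp hc))
      have : M ^ 2 < x ^ 2 := by
        rw [← sq_abs x]; exact pow_lt_pow_left₀ this hM.le two_ne_zero
      nlinarith [sq_nonneg p])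
    (locallyIntegrable_const _) hG.contDiffOn
  rw [contDiffOn_univ] at key
  convert key using 2 with s
  simp [radon, convolution, G, sub_eq_add_neg]

/-- Two-dimensional (two-sided) Laplace transform. -/
noncomputable def laplace2 (φ : ℝ × ℝ → ℝ) (ξ : ℝ × ℝ) : ℝ :=
  ∫ x : ℝ × ℝ, φ x * Real.exp (ξ.1 * x.1 + ξ.2 * x.2)

lemma laplace2_continuous {φ : ℝ × ℝ → ℝ} (hφ : Continuous φ) (hc : HasCompactSupport φ) :
    Continuous (laplace2 φ) := by
  have h := continuous_parametric_integral_of_continuous (μ := (volume : Measure (ℝ × ℝ)))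
    (f := fun (ξ x : ℝ × ℝ) => φ x * Real.exp (ξ.1 * x.1 + ξ.2 * x.2))
    (by simp only [Function.uncurry_def]; fun_prop) (s := tsupport φ) hc
  convert h using 2 with ξ
  unfold laplace2
  rw [setIntegral_eq_integral_of_forall_compl_eq_zero]
  intro x hx
  rw [image_eq_zero_of_notMem_tsupport hx, zero_mul]

/-- Rotation as a linear map. -/
noncomputable def rotL (θ : ℝ) : ℝ × ℝ →ₗ[ℝ] ℝ × ℝ :=
  Matrix.toLin (Module.Basis.finTwoProd ℝ) (Module.Basis.finTwoProd ℝ)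
    !![Real.cos θ, -Real.sin θ; Real.sin θ, Real.cos θ]

lemma rotL_apply (θ : ℝ) (p : ℝ × ℝ) : rotL θ p =
    (p.1 * Real.cos θ - p.2 * Real.sin θ, p.1 * Real.sin θ + p.2 * Real.cos θ) := by
  unfold rotL
  rw [Matrix.toLin_finTwoProd_apply]
  ext <;> simp <;> ring

lemma rotL_det (θ : ℝ) : LinearMap.det (rotL θ) = 1 := by
  unfold rotL
  rw [LinearMap.det_toLin, Matrix.det_fin_two_of]
  linear_combination Real.cos_sq_add_sin_sq θ

lemma rot_integral (θ : ℝ) {F : ℝ × ℝ → ℝ} (hF : Continuous F) :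
    ∫ p, F (rotL θ p) = ∫ x, F x := by
  have h := Measure.map_linearMap_addHaar_eq_smul_addHaar (μ := (volume : Measure (ℝ × ℝ)))
    (f := rotL θ) (by rw [rotL_det]; exact one_ne_zero)
  rw [rotL_det] at h
  simp only [inv_one, abs_one, ENNReal.ofReal_one, one_smul] at h
  conv_rhs => rw [← h]
  rw [integral_map ((rotL θ).continuous_of_finiteDimensional.aemeasurable)
    hF.aestronglyMeasurable]

lemma radon_laplace {φ : ℝ × ℝ → ℝ} (hφ : Continuous φ) (hc : HasCompactSupport φ) (θ r : ℝ) :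
    ∫ s, radon φ s θ * Real.exp (r * s) = laplace2 φ (r * Real.cos θ, r * Real.sin θ) := by
  have hcont : Continuous (fun x : ℝ × ℝ =>
      φ x * Real.exp (r * Real.cos θ * x.1 + r * Real.sin θ * x.2)) := by fun_prop
  have hint : Integrable (fun x : ℝ × ℝ =>
      φ x * Real.exp (r * Real.cos θ * x.1 + r * Real.sin θ * x.2)) :=
    hcont.integrable_of_hasCompactSupport hc.mul_right
  have hint2 : Integrable (fun p : ℝ × ℝ => φ (rotL θ p) * Real.exp (r * Real.cos θ * (rotL θ p).1
      + r * Real.sin θ * (rotL θ p).2)) := by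
    have h := Measure.map_linearMap_addHaar_eq_smul_addHaar (μ := (volume : Measure (ℝ × ℝ)))
      (f := rotL θ) (by rw [rotL_det]; exact one_ne_zero)
    rw [rotL_det] at h
    simp only [inv_one, abs_one, ENNReal.ofReal_one, one_smul] at h
    rw [← h] at hint
    exact hint.comp_aemeasurable ((rotL θ).continuous_of_finiteDimensional.aemeasurable)
  unfold laplace2
  rw [← rot_integral θ hcont, Measure.volume_eq_prod, integral_prod _ hint2]
  congr 1
  funext s
  unfold radon
  rw [← integral_mul_const]
  congr 1
  funext t
  rw [rotL_apply]
  congr 2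
  simp only
  linear_combination (-r * s) * Real.cos_sq_add_sin_sq θ

lemma laplace2_injective {φ : ℝ × ℝ → ℝ} (hφ : Continuous φ) (hc : HasCompactSupport φ)
    (h0 : ∀ ξ, laplace2 φ ξ = 0) : φ = 0 := by
  let E : ℝ × ℝ → C(ℝ × ℝ, ℝ) := fun ξ =>
    ⟨fun x => Real.exp (ξ.1 * x.1 + ξ.2 * x.2), by fun_prop⟩
  let S : Submonoid C(ℝ × ℝ, ℝ) :=
    { carrier := Set.range E
      one_mem' := ⟨0, by ext s; simp [E]⟩
      mul_mem' := by
        rintro _ _ ⟨a, rfl⟩ ⟨b, rfl⟩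
        refine ⟨a + b, ?_⟩
        ext s
        simp only [E, ContinuousMap.coe_mk, ContinuousMap.mul_apply, Prod.fst_add, Prod.snd_add]
        rw [← Real.exp_add]
        ring_nf }
  refine eq_zero_of_integral_submonoid volume hφ hc S ?_ ?_
  · intro x y hxy
    by_cases h1 : x.1 = y.1
    · refine ⟨E (0, 1), ⟨_, rfl⟩, ?_⟩
      have h2 : x.2 ≠ y.2 := fun h2 => hxy (Prod.ext h1 h2)
      simpa [E] using h2
    · exact ⟨E (1, 0), ⟨_, rfl⟩, by simpa [E] using h1⟩
  · rintro _ ⟨ξ, rfl⟩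
    exact h0 ξ

/-- The density whose Abel transform is (a multiple of) the radiation field. -/
noncomputable def dens (φ0 φ1 : ℝ × ℝ → ℝ) (θ s : ℝ) : ℝ :=
  radon φ1 s θ - deriv (fun s' => radon φ0 s' θ) s

lemma hasCompactSupport_of_abs {M : ℝ} {g : ℝ → ℝ} (h : ∀ s, M < |s| → g s = 0) :
    HasCompactSupport g := by
  refine HasCompactSupport.intro (K := Set.Icc (-M) M) isCompact_Icc fun s hs => h s ?_
  by_contra hc
  exact hs (abs_le.mp (not_lt.mp hc))

lemma deriv_radon_zero {M : ℝ} (hM : 0 < M) {φ0 : ℝ × ℝ → ℝ} (hs0 : SuppIn M φ0) (θ : ℝ) {s : ℝ} (hs : M < |s|) : deriv (fun s' => radon φ0 s' θ) s = 0 := by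
  have : (fun s' => radon φ0 s' θ) =ᶠ[𝓝 s] fun _ => 0 := by
    have ho : IsOpen {x : ℝ | M < |x|} := isOpen_lt continuous_const continuous_abs
    filter_upwards [ho.mem_nhds hs] with x hx
    exact radon_zero hM hs0 θ hx
  rw [this.deriv_eq]; simp

lemma dens_zero {M : ℝ} (hM : 0 < M) {φ0 φ1 : ℝ × ℝ → ℝ} (hs0 : SuppIn M φ0) (hs1 : SuppIn M φ1) (θ : ℝ) {s : ℝ} (hs : M < |s|) : dens φ0 φ1 θ s = 0 := by
  rw [dens, radon_zero hM hs1 θ hs, deriv_radon_zero hM hs0 θ hs, sub_zero]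

lemma deriv_radon_contDiff {M : ℝ} (hM : 0 < M) {φ0 : ℝ × ℝ → ℝ} (hφ0 : ContDiff ℝ (⊤ : ℕ∞) φ0) (hs0 : SuppIn M φ0) (θ : ℝ) : ContDiff ℝ (⊤ : ℕ∞) (deriv (fun s' => radon φ0 s' θ)) :=
  (contDiff_infty_iff_deriv.1 (radon_contDiff hM hφ0 hs0 θ)).2

lemma dens_contDiff {M : ℝ} (hM : 0 < M) {φ0 φ1 : ℝ × ℝ → ℝ} (hφ0 : ContDiff ℝ (⊤ : ℕ∞) φ0) (hφ1 : ContDiff ℝ (⊤ : ℕ∞) φ1)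
    (hs0 : SuppIn M φ0) (hs1 : SuppIn M φ1) (θ : ℝ) : ContDiff ℝ (⊤ : ℕ∞) (dens φ0 φ1 θ) :=
  (radon_contDiff hM hφ1 hs1 θ).sub (deriv_radon_contDiff hM hφ0 hs0 θ)

lemma F0_eq {φ0 φ1 : ℝ × ℝ → ℝ} (θ : ℝ) (σ : ℝ) : F0 φ0 φ1 σ θ =
    (1 / (2 * Real.pi * Real.sqrt 2)) * abelT (dens φ0 φ1 θ) σ := rfl

lemma laplace_of_F0_zero {M : ℝ} (hM : 0 < M) {φ0 φ1 : ℝ × ℝ → ℝ} (hφ0 : ContDiff ℝ (⊤ : ℕ∞) φ0) (hφ1 : ContDiff ℝ (⊤ : ℕ∞) φ1)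
    (hs0 : SuppIn M φ0) (hs1 : SuppIn M φ1) (θ : ℝ)
    (h0 : ∀ σ, F0 φ0 φ1 σ θ = 0) (r : ℝ) :
    laplace2 φ1 (r * Real.cos θ, r * Real.sin θ) +
      r * laplace2 φ0 (r * Real.cos θ, r * Real.sin θ) = 0 := by
  have hA : ∀ σ, abelT (dens φ0 φ1 θ) σ = 0 := by
    intro σ
    have := h0 σ
    rw [F0_eq] at this
    refine (mul_eq_zero.mp this).resolve_left ?_
    positivity
  have hd : dens φ0 φ1 θ = 0 := abelT_injective (dens_contDiff hM hφ0 hφ1 hs0 hs1 θ).continuous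
    (hasCompactSupport_of_abs fun s hs => dens_zero hM hs0 hs1 θ hs) hA
  have hR : ∀ s, radon φ1 s θ = deriv (fun s' => radon φ0 s' θ) s := by
    intro s
    have := congrFun hd s
    simp only [dens, Pi.zero_apply] at this
    linarith
  rw [← radon_laplace hφ1.continuous (hs1.hasCompactSupport hM),
    ← radon_laplace hφ0.continuous (hs0.hasCompactSupport hM)]
  simp_rw [hR]
  have hc : HasCompactSupport (fun s => radon φ0 s θ) :=
    hasCompactSupport_of_abs fun s hs => radon_zero hM hs0 θ hs
  have hc' : HasCompactSupport (deriv (fun s => radon φ0 s θ)) :=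
    hasCompactSupport_of_abs fun s hs => deriv_radon_zero hM hs0 θ hs
  have hcd := radon_contDiff hM hφ0 hs0 θ
  have hcd' := (deriv_radon_contDiff hM hφ0 hs0 θ).continuous
  have hcc := hcd.continuous
  have key := integral_mul_deriv_eq_deriv_mul_of_integrable
    (u := fun s => Real.exp (r * s)) (u' := fun s => r * Real.exp (r * s))
    (v := fun s => radon φ0 s θ) (v' := deriv (fun s => radon φ0 s θ))
    (fun x _ => by
      have := ((hasDerivAt_id x).const_mul r).exp
      simpa [mul_comm] using this)
    (fun x _ => (hcd.differentiable (by simp) x).hasDerivAt)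
    (Continuous.integrable_of_hasCompactSupport
      ((show Continuous fun s => Real.exp (r * s) by fun_prop).mul hcd') hc'.mul_left)
    (Continuous.integrable_of_hasCompactSupport
      ((show Continuous fun s => r * Real.exp (r * s) by fun_prop).mul hcc) hc.mul_left)
    (Continuous.integrable_of_hasCompactSupport
      ((show Continuous fun s => Real.exp (r * s) by fun_prop).mul hcc) hc.mul_left)
  simp_rw [mul_comm (deriv (fun s' => radon φ0 s' θ) _)]
  rw [key, ← integral_const_mul]
  simp_rw [mul_assoc, mul_comm (radon φ0 _ θ)]
  simp

lemma exists_polar (ξ : ℝ × ℝ) : ∃ r θ : ℝ, ξ = (r * Real.cos θ, r * Real.sin θ) := by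
  refine ⟨‖(⟨ξ.1, ξ.2⟩ : ℂ)‖, Complex.arg ⟨ξ.1, ξ.2⟩, ?_⟩
  rw [Complex.norm_mul_cos_arg, Complex.norm_mul_sin_arg]

/-- The quadratic symbol. -/
noncomputable def symD (d : Fin 3 → Fin 3 → ℝ) (θ : ℝ) : ℝ :=
  ∑ i : Fin 3, ∑ j : Fin 3, d i j * omegaHat θ i * omegaHat θ j

/-- The cubic symbol. -/
noncomputable def symE (e : Fin 3 → Fin 3 → Fin 3 → ℝ) (θ : ℝ) : ℝ :=
  ∑ i : Fin 3, ∑ j : Fin 3, ∑ k : Fin 3, e i j k * omegaHat θ i * omegaHat θ j * omegaHat θ k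

lemma omegaHat_analytic (i : Fin 3) : AnalyticOnNhd ℝ (fun θ => omegaHat θ i) Set.univ := by
  intro x _
  fin_cases i
  · exact analyticAt_const
  · exact Real.analyticAt_cos
  · exact Real.analyticAt_sin

lemma symD_analytic (d : Fin 3 → Fin 3 → ℝ) : AnalyticOnNhd ℝ (symD d) Set.univ := by
  unfold symD
  refine Finset.analyticOnNhd_fun_sum _ fun i _ => Finset.analyticOnNhd_fun_sum _ fun j _ => ?_
  exact (analyticOnNhd_const.mul (omegaHat_analytic i)).mul (omegaHat_analytic j)

lemma symE_analytic (e : Fin 3 → Fin 3 → Fin 3 → ℝ) : AnalyticOnNhd ℝ (symE e) Set.univ := by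
  unfold symE
  refine Finset.analyticOnNhd_fun_sum _ fun i _ => Finset.analyticOnNhd_fun_sum _ fun j _ =>
    Finset.analyticOnNhd_fun_sum _ fun k _ => ?_
  exact ((analyticOnNhd_const.mul (omegaHat_analytic i)).mul (omegaHat_analytic j)).mul
    (omegaHat_analytic k)

lemma eventually_ne_of_analytic {f : ℝ → ℝ} (hf : AnalyticOnNhd ℝ f Set.univ)
    (hne : ∃ x, f x ≠ 0) (x : ℝ) : ∀ᶠ y in 𝓝[≠] x, f y ≠ 0 := by
  rcases (hf x (Set.mem_univ x)).eventually_eq_zero_or_eventually_ne_zero with h | h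
  · exfalso
    obtain ⟨z, hz⟩ := hne
    exact hz (hf.eqOn_zero_of_preconnected_of_eventuallyEq_zero isPreconnected_univ
      (Set.mem_univ x) h (Set.mem_univ z))
  · exact h

lemma symD_ne (d : Fin 3 → Fin 3 → ℝ)
    (hdsymm : ∀ i j, d i j = d j i) (hd00 : d 0 0 = 0)
    (hdne : ∃ i j : Fin 3, (i, j) ≠ ((0 : Fin 3), (0 : Fin 3)) ∧ d i j ≠ 0) :
    ∃ θ, symD d θ ≠ 0 := by
  by_contra hcon
  push Not at hcon
  have h1 := hcon 0
  have h2 := hcon Real.pi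
  have h3 := hcon (Real.pi / 2)
  have h4 := hcon (-(Real.pi / 2))
  have h5 := hcon (Real.pi / 4)
  have s1 := hdsymm 1 0
  have s2 := hdsymm 2 0
  have s3 := hdsymm 2 1
  have hq : (Real.sqrt 2 / 2) * (Real.sqrt 2 / 2) = 1 / 2 := by
    have := Real.mul_self_sqrt (show (0 : ℝ) ≤ 2 by norm_num)
    linarith
  simp [symD, Fin.sum_univ_three, omegaHat, hd00, s1, s2, s3] at h1 h2 h3 h4 h5
  have a1 : d 0 1 = 0 := by linarith
  have a2 : d 1 1 = 0 := by linarith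
  have a3 : d 0 2 = 0 := by linarith
  have a4 : d 2 2 = 0 := by linarith
  have a5 : d 1 2 = 0 := by
    rw [a1, a2, a3, a4] at h5
    linear_combination h5 - 2 * d 1 2 * hq
  obtain ⟨i, j, -, hij⟩ := hdne
  apply hij
  fin_cases i <;> fin_cases j <;> simp [hd00, s1, s2, s3, a1, a2, a3, a4, a5]

lemma symE_ne (e : Fin 3 → Fin 3 → Fin 3 → ℝ) (h : NullCondFails e) : ∃ θ, symE e θ ≠ 0 := by
  obtain ⟨ξ, h1, h2, h3⟩ := h
  have hpos : 0 < ξ 1 ^ 2 + ξ 2 ^ 2 := by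
    rcases h2 with h | h <;> positivity
  have h0 : ξ 0 ≠ 0 := by
    intro h; rw [h] at h1; norm_num at h1; linarith
  obtain ⟨r, θ, hr⟩ := exists_polar (ξ 1, ξ 2)
  have e1 : ξ 1 = r * Real.cos θ := congrArg Prod.fst hr
  have e2 : ξ 2 = r * Real.sin θ := congrArg Prod.snd hr
  have hr2 : ξ 0 ^ 2 = r ^ 2 := by
    rw [h1, e1, e2]; linear_combination r ^ 2 * Real.cos_sq_add_sin_sq θ
  have main : ∀ (ρ θ : ℝ), (∀ i, ξ i = ρ * omegaHat θ i) → symE e θ ≠ 0 := by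
    intro ρ θ hξ hz
    apply h3
    have : ∑ i : Fin 3, ∑ j : Fin 3, ∑ k : Fin 3, e i j k * ξ i * ξ j * ξ k
        = ρ ^ 3 * symE e θ := by
      unfold symE
      simp_rw [Finset.mul_sum, hξ]
      refine Finset.sum_congr rfl fun i _ => Finset.sum_congr rfl fun j _ =>
        Finset.sum_congr rfl fun k _ => by ring
    rw [this, hz, mul_zero]
  rcases sq_eq_sq_iff_eq_or_eq_neg.mp hr2 with h | h
  · refine ⟨θ + Real.pi, main (-r) _ fun i => ?_⟩
    fin_cases i <;> simp [omegaHat, h, e1, e2]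
  · refine ⟨θ, main r _ fun i => ?_⟩
    fin_cases i <;> simp [omegaHat, h, e1, e2]

/-- Step 3 in the proof of Lemma 2.1: `B ≠ ∅`; equivalently, there is a point
`(σ,θ) ∈ (−∞,M)×[0,2π]` with `F₁ ≠ 0`, `F₂ > 0` and `F₁ + F₂ > 0`. -/
theorem setB_nonempty
    (M : ℝ) (hM : 0 < M)
    (φ0 φ1 : ℝ × ℝ → ℝ)
    (hφ0 : ContDiff ℝ (⊤ : ℕ∞) φ0) (hφ1 : ContDiff ℝ (⊤ : ℕ∞) φ1)
    (hs0 : SuppIn M φ0) (hs1 : SuppIn M φ1)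
    (d : Fin 3 → Fin 3 → ℝ)
    (hdsymm : ∀ i j, d i j = d j i) (hd00 : d 0 0 = 0)
    (hdne : ∃ i j : Fin 3, (i, j) ≠ ((0 : Fin 3), (0 : Fin 3)) ∧ d i j ≠ 0)
    (e : Fin 3 → Fin 3 → Fin 3 → ℝ)
    (hnull : NullCondFails e)
    (hne : φ0 ≠ 0 ∨ φ1 ≠ 0) :
    (setB M d e φ0 φ1).Nonempty ∧
    ∃ p : ℝ × ℝ, p.1 < M ∧ p.2 ∈ Set.Icc 0 (2 * Real.pi) ∧
      F1 d φ0 φ1 p.1 p.2 ≠ 0 ∧ 0 < F2 e φ0 φ1 p.1 p.2 ∧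
      0 < F1 d φ0 φ1 p.1 p.2 + F2 e φ0 φ1 p.1 p.2 := by
  have main : ∃ p : ℝ × ℝ, p.1 < M ∧ p.2 ∈ Set.Icc 0 (2 * Real.pi) ∧
      F1 d φ0 φ1 p.1 p.2 ≠ 0 ∧ 0 < F2 e φ0 φ1 p.1 p.2 ∧
      0 < F1 d φ0 φ1 p.1 p.2 + F2 e φ0 φ1 p.1 p.2 := by
    by_contra hcon
    have hc0 := hs0.hasCompactSupport hM
    have hc1 := hs1.hasCompactSupport hM
    have hL0 := laplace2_continuous hφ0.continuous hc0
    have hL1 := laplace2_continuous hφ1.continuous hc1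
    -- vanishing for good angles in `[0, 2π]`
    have step1 : ∀ θ ∈ Set.Icc 0 (2 * Real.pi), symD d θ ≠ 0 → symE e θ ≠ 0 → ∀ r : ℝ,
        laplace2 φ1 (r * Real.cos θ, r * Real.sin θ) +
          r * laplace2 φ0 (r * Real.cos θ, r * Real.sin θ) = 0 := by
      intro θ hθ hD hE
      refine laplace_of_F0_zero hM hφ0 hφ1 hs0 hs1 θ ?_
      by_contra hF
      push Not at hF
      have hz : ∀ s, M < |s| → dens φ0 φ1 θ s = 0 := fun s hs => dens_zero hM hs0 hs1 θ hs
      have hsm := dens_contDiff hM hφ0 hφ1 hs0 hs1 θ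
      have hcs := hasCompactSupport_of_abs hz
      have hF0 : (fun σ => F0 φ0 φ1 σ θ) =
          fun σ => (1 / (2 * Real.pi * Real.sqrt 2)) * abelT (dens φ0 φ1 θ) σ := rfl
      have hcd : ContDiff ℝ 2 (fun σ => F0 φ0 φ1 σ θ) := by
        rw [hF0]
        exact contDiff_const.mul (contDiff_infty.1 (abelT_contDiff hsm hcs) 2)
      have hlim : Tendsto (fun σ => F0 φ0 φ1 σ θ) atBot (𝓝 0) := by
        rw [hF0]
        simpa using (abelT_tendsto hz
          (hsm.continuous.integrable_of_hasCompactSupport hcs)).const_mul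
            (1 / (2 * Real.pi * Real.sqrt 2))
      obtain ⟨x, hx, h1, h2, h3⟩ := core_one_dim hcd (M := M)
        (fun x hx => by rw [F0_eq, abelT_zero hz hx, mul_zero]) hlim hF hD hE
      exact hcon ⟨(x, θ), hx, hθ, h1, h2, h3⟩
    -- all good angles
    have step2 : ∀ θ, symD d θ ≠ 0 → symE e θ ≠ 0 → ∀ r : ℝ,
        laplace2 φ1 (r * Real.cos θ, r * Real.sin θ) +
          r * laplace2 φ0 (r * Real.cos θ, r * Real.sin θ) = 0 := by
      intro θ hD hE r
      have hmem := toIcoMod_mem_Ico Real.two_pi_pos 0 θ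
      have hval : toIcoMod Real.two_pi_pos 0 θ =
        θ - toIcoDiv Real.two_pi_pos 0 θ * (2 * Real.pi) := by
        rw [toIcoMod, zsmul_eq_mul]
      have hcos : Real.cos (toIcoMod Real.two_pi_pos 0 θ) = Real.cos θ := by
        rw [hval, Real.cos_sub_int_mul_two_pi]
      have hsin : Real.sin (toIcoMod Real.two_pi_pos 0 θ) = Real.sin θ := by
        rw [hval, Real.sin_sub_int_mul_two_pi]
      have hom : omegaHat (toIcoMod Real.two_pi_pos 0 θ) = omegaHat θ := by
        unfold omegaHat; rw [hcos, hsin]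
      have := step1 (toIcoMod Real.two_pi_pos 0 θ) ⟨hmem.1, by linarith [hmem.2]⟩
        (by unfold symD; rw [hom]; exact hD) (by unfold symE; rw [hom]; exact hE) r
      rwa [hcos, hsin] at this
    -- all angles, by density
    have step3 : ∀ θ r : ℝ, laplace2 φ1 (r * Real.cos θ, r * Real.sin θ) +
          r * laplace2 φ0 (r * Real.cos θ, r * Real.sin θ) = 0 := by
      intro θ r
      have hcont : Continuous (fun θ => laplace2 φ1 (r * Real.cos θ, r * Real.sin θ) +
          r * laplace2 φ0 (r * Real.cos θ, r * Real.sin θ)) := by fun_prop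
      have hev : ∀ᶠ y in 𝓝[≠] θ, laplace2 φ1 (r * Real.cos y, r * Real.sin y) +
          r * laplace2 φ0 (r * Real.cos y, r * Real.sin y) = 0 := by
        filter_upwards [eventually_ne_of_analytic (symD_analytic d)
          (symD_ne d hdsymm hd00 hdne) θ,
          eventually_ne_of_analytic (symE_analytic e) (symE_ne e hnull) θ] with y h1 h2
        exact step2 y h1 h2 r
      exact tendsto_nhds_unique ((hcont.tendsto θ).mono_left nhdsWithin_le_nhds)
        (tendsto_const_nhds.congr' (hev.mono fun y hy => hy.symm))
    -- separate the two transforms by replacing `(r, θ)` by `(-r, θ + π)`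
    have step4 : ∀ θ r : ℝ, laplace2 φ1 (r * Real.cos θ, r * Real.sin θ) = 0 ∧
          r * laplace2 φ0 (r * Real.cos θ, r * Real.sin θ) = 0 := by
      intro θ r
      have h1 := step3 θ r
      have h2 := step3 (θ + Real.pi) (-r)
      simp only [Real.cos_add_pi, Real.sin_add_pi, neg_mul_neg] at h2
      constructor <;> linarith
    have z1 : φ1 = 0 := by
      refine laplace2_injective hφ1.continuous hc1 fun ξ => ?_
      obtain ⟨r, θ, rfl⟩ := exists_polar ξ
      exact (step4 θ r).1
    have z0 : φ0 = 0 := by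
      have hz : ∀ ξ, ξ ≠ 0 → laplace2 φ0 ξ = 0 := by
        intro ξ hξ
        obtain ⟨r, θ, rfl⟩ := exists_polar ξ
        refine (mul_eq_zero.mp (step4 θ r).2).resolve_left ?_
        rintro rfl
        exact hξ (by simp)
      refine laplace2_injective hφ0.continuous hc0 fun ξ => ?_
      by_cases hξ : ξ = 0
      · subst hξ
        refine tendsto_nhds_unique ((hL0.tendsto 0).mono_left
          (nhdsWithin_le_nhds (s := {0}ᶜ))) (tendsto_const_nhds.congr' ?_)
        filter_upwards [self_mem_nhdsWithin] with y hy
        exact (hz y hy).symm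
      · exact hz ξ hξ
    exact hne.elim (fun h => h z0) (fun h => h z1)
  refine ⟨?_, main⟩
  obtain ⟨p, h1, h2, h3, h4, h5⟩ := main
  have hpos : 0 < 1 + F1 d φ0 φ1 p.1 p.2 / F2 e φ0 φ1 p.1 p.2 := by
    have : 1 + F1 d φ0 φ1 p.1 p.2 / F2 e φ0 φ1 p.1 p.2 =
      (F1 d φ0 φ1 p.1 p.2 + F2 e φ0 φ1 p.1 p.2) / F2 e φ0 φ1 p.1 p.2 := by
      field_simp; ring
    rw [this]; exact div_pos h5 h4
  refine ⟨p, ⟨h1, h2, h3, h4.ne', hpos⟩, ?_⟩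
  unfold G0
  rcases lt_or_gt_of_ne h3 with h | h
  · refine mul_pos_of_neg_of_neg (one_div_neg.mpr h) (Real.log_neg hpos ?_)
    have := div_neg_of_neg_of_pos h h4
    linarith
  · refine mul_pos (one_div_pos.mpr h) (Real.log_pos ?_)
    have := div_pos h h4
    linarith
end

section
/- Assume (φ₀,φ₁) ≢ 0 and let D = {(σ,θ) ∈ (−∞,M)×[0,2π] : F₁(σ,θ) = 0, F₂(σ,θ) > 0}, assumed nonempty. Then inf_{(σ,θ)∈D} 1/F₂(σ,θ) ≥ τ₀; in particular, defining G̃₀ = G₀ on A and G̃₀ = 1/F₂ on D, one has min{τ₀, inf_{(σ,θ)∈D} G̃₀(σ,θ)} = τ₀. -/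
open Real MeasureTheory Filter Topology Asymptotics

open scoped Convolution

theorem aux_radon_smooth (M : ℝ) (hM : 0 < M) (v : ℝ × ℝ → ℝ) (hv : ContDiff ℝ (⊤ : ℕ∞) v)
    (hs : SuppIn M v) : ContDiff ℝ (⊤ : ℕ∞) (fun p : ℝ × ℝ => radon v p.1 p.2) := by
  let g : (ℝ × ℝ) → ℝ → ℝ := fun p y =>
    v (p.1 * Real.cos p.2 + y * Real.sin p.2, p.1 * Real.sin p.2 - y * Real.cos p.2)
  have hg : ContDiff ℝ (⊤ : ℕ∞) (↿g) := by
    apply hv.comp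
    have h1 : ContDiff ℝ (⊤ : ℕ∞) (fun q : (ℝ × ℝ) × ℝ => Real.cos q.1.2) := 
      Real.contDiff_cos.comp (by fun_prop)
    have h2 : ContDiff ℝ (⊤ : ℕ∞) (fun q : (ℝ × ℝ) × ℝ => Real.sin q.1.2) := 
      Real.contDiff_sin.comp (by fun_prop)
    fun_prop
  have key := contDiffOn_convolution_right_with_param (𝕜 := ℝ) (μ := (volume : Measure ℝ))
    (f := fun _ : ℝ => (1 : ℝ)) (n := (⊤ : ℕ∞)) (ContinuousLinearMap.mul ℝ ℝ) (g := g)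
    (s := Set.univ) (k := Set.Icc (-M) M) isOpen_univ isCompact_Icc
    (by
      intro p x _ hx
      apply hs
      have h3 : M ^ 2 < x ^ 2 := by
        rw [sq_lt_sq]
        rw [abs_of_pos hM]
        by_contra hcon
        exact hx (abs_le.mp (not_lt.mp hcon))
      have h4 := Real.sin_sq_add_cos_sq p.2
      have : (p.1 * Real.cos p.2 + x * Real.sin p.2) ^ 2 +
        (p.1 * Real.sin p.2 - x * Real.cos p.2) ^ 2 = p.1 ^ 2 + x ^ 2 := by
        linear_combination (p.1 ^ 2 + x ^ 2) * h4
      simp only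
      rw [this]
      nlinarith [sq_nonneg p.1])
    (locallyIntegrable_const _) hg.contDiffOn
  rw [Set.univ_prod_univ, contDiffOn_univ] at key
  have h5 : (fun p : ℝ × ℝ => radon v p.1 p.2) =
      (fun q : (ℝ × ℝ) × ℝ => ((fun _ : ℝ => (1 : ℝ)) ⋆[ContinuousLinearMap.mul ℝ ℝ, volume] g q.1) q.2)
        ∘ (fun p : ℝ × ℝ => (p, (0 : ℝ))) := by
    funext p
    simp only [Function.comp, convolution, radon, g, ContinuousLinearMap.mul_apply', one_mul]
    congr 1
    funext t
    congr 2 <;> ring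
  rw [h5]
  exact key.comp (by fun_prop)

theorem aux_dsmooth (f : ℝ × ℝ → ℝ) (hf : ContDiff ℝ (⊤ : ℕ∞) f) :
    ContDiff ℝ (⊤ : ℕ∞) (fun p : ℝ × ℝ => deriv (fun s => f (s, p.2)) p.1) := by
  have h : (fun p : ℝ × ℝ => deriv (fun s => f (s, p.2)) p.1) =
      fun p => fderiv ℝ f p (1, 0) := by
    funext p
    have h1 : HasFDerivAt f (fderiv ℝ f (p.1, p.2)) (p.1, p.2) :=
      (hf.differentiable (by simp) _).hasFDerivAt
    have h2 : HasDerivAt (fun s : ℝ => (s, p.2)) ((1 : ℝ), (0 : ℝ)) p.1 :=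
      (hasDerivAt_id _).prodMk (hasDerivAt_const _ _)
    exact (h1.comp_hasDerivAt p.1 h2).deriv
  rw [h]
  exact (hf.fderiv_right (m := (⊤ : ℕ∞)) (by simp)).clm_apply contDiff_const

theorem aux_locInt : LocallyIntegrable (fun t : ℝ => (Real.sqrt (-t))⁻¹) volume := by
  have h0 : ∀ x : ℝ, (Real.sqrt x)⁻¹ = x ^ (-(1 / 2) : ℝ) := by
    intro x
    rcases lt_trichotomy x 0 with h | h | h
    · rw [Real.sqrt_eq_zero_of_nonpos h.le, Real.rpow_def_of_neg h]
      have : (-(1 / 2) : ℝ) * Real.pi = -(Real.pi / 2) := by ring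
      rw [this]
      simp
    · subst h
      rw [Real.zero_rpow (by norm_num)]
      simp
    · rw [Real.rpow_neg h.le, Real.sqrt_eq_rpow]
  intro x
  refine ⟨Set.Icc (x - 1) (x + 1), Icc_mem_nhds (by linarith) (by linarith), ?_⟩
  rw [← intervalIntegrable_iff_integrableOn_Icc_of_le (by linarith)]
  simp only [h0]
  have := (intervalIntegral.intervalIntegrable_rpow' (a := -(x - 1)) (b := -(x + 1))
    (r := -(1 / 2)) (by norm_num)).comp_mul_left (c := -1)
  have e1 : -(x - 1) / -1 = x - 1 := by ring
  have e2 : -(x + 1) / -1 = x + 1 := by ring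
  rw [e1, e2] at this
  simpa using this

theorem aux_F0_smooth (M : ℝ) (hM : 0 < M) (φ0 φ1 : ℝ × ℝ → ℝ)
    (hφ0 : ContDiff ℝ (⊤ : ℕ∞) φ0) (hφ1 : ContDiff ℝ (⊤ : ℕ∞) φ1)
    (hs0 : SuppIn M φ0) (hs1 : SuppIn M φ1) :
    ContDiff ℝ (⊤ : ℕ∞) (fun p : ℝ × ℝ => F0 φ0 φ1 p.1 p.2) := by
  let g : ℝ → ℝ → ℝ := fun θ s => radon φ1 s θ - deriv (fun s' => radon φ0 s' θ) s
  have hR1 := aux_radon_smooth M hM φ1 hφ1 hs1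
  have hR0 := aux_dsmooth _ (aux_radon_smooth M hM φ0 hφ0 hs0)
  have hg : ContDiff ℝ (⊤ : ℕ∞) (↿g) := 
    (hR1.sub hR0).comp (f := fun q : ℝ × ℝ => (q.2, q.1)) (by fun_prop)
  have hz : ∀ v : ℝ × ℝ → ℝ, SuppIn M v → ∀ s θ : ℝ, M < |s| → radon v s θ = 0 := by
    intro v hv s θ hsM
    unfold radon
    have : ∀ t : ℝ, v (s * Real.cos θ - t * Real.sin θ, s * Real.sin θ + t * Real.cos θ) = 0 := by
      intro t
      apply hv
      have h4 := Real.sin_sq_add_cos_sq θ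
      have h5 : (s * Real.cos θ - t * Real.sin θ) ^ 2 +
        (s * Real.sin θ + t * Real.cos θ) ^ 2 = s ^ 2 + t ^ 2 := by
        linear_combination (s ^ 2 + t ^ 2) * h4
      simp only
      rw [h5]
      have : M ^ 2 < s ^ 2 := by
        rw [sq_lt_sq, abs_of_pos hM]
        exact hsM
      nlinarith [sq_nonneg t]
    simp [this]
  have key := contDiffOn_convolution_right_with_param (𝕜 := ℝ) (μ := (volume : Measure ℝ))
    (f := fun t : ℝ => (Real.sqrt (-t))⁻¹) (n := (⊤ : ℕ∞)) (ContinuousLinearMap.mul ℝ ℝ) (g := g)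
    (s := Set.univ) (k := Set.Icc (-M) M) isOpen_univ isCompact_Icc
    (by
      intro θ x _ hx
      have hx' : M < |x| := by
        by_contra hcon
        exact hx (abs_le.mp (not_lt.mp hcon))
      have hev : (fun s' => radon φ0 s' θ) =ᶠ[𝓝 x] fun _ => 0 := by
        filter_upwards [continuous_abs.continuousAt.eventually (lt_mem_nhds hx')] with s hs
        exact hz φ0 hs0 s θ hs
      simp only [g]
      rw [hz φ1 hs1 x θ hx', hev.deriv_eq]
      simp)
    aux_locInt hg.contDiffOn
  rw [Set.univ_prod_univ, contDiffOn_univ] at key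
  have h5 : (fun p : ℝ × ℝ => F0 φ0 φ1 p.1 p.2) = fun p : ℝ × ℝ =>
      (1 / (2 * Real.pi * Real.sqrt 2)) *
      ((fun t : ℝ => (Real.sqrt (-t))⁻¹) ⋆[ContinuousLinearMap.mul ℝ ℝ, volume] g p.2) p.1 := by
    funext p
    unfold F0
    congr 1
    rw [convolution_eq_swap, setIntegral_eq_integral_of_forall_compl_eq_zero]
    · congr 1
      funext t
      simp only [ContinuousLinearMap.mul_apply', g, neg_sub]
      rw [div_eq_mul_inv, mul_comm]
    · intro x hx
      rw [Real.sqrt_eq_zero_of_nonpos (by simpa using hx)]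
      simp
  rw [h5]
  exact contDiff_const.mul (key.comp (f := fun q : ℝ × ℝ => (q.2, q.1)) (by fun_prop))

/-- The quadratic form restricted to the circle. -/
noncomputable def auxa (d : Fin 3 → Fin 3 → ℝ) (θ : ℝ) : ℝ :=
  ∑ i : Fin 3, ∑ j : Fin 3, d i j * omegaHat θ i * omegaHat θ j

theorem auxa_eq (d : Fin 3 → Fin 3 → ℝ) 
    (hdsymm : ∀ i j, d i j = d j i) (hd00 : d 0 0 = 0) (θ : ℝ) :
    auxa d θ = -2 * d 0 1 * Real.cos θ - 2 * d 0 2 * Real.sin θ + d 1 1 * Real.cos θ ^ 2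
      + 2 * d 1 2 * (Real.cos θ * Real.sin θ) + d 2 2 * Real.sin θ ^ 2 := by
  simp only [auxa, omegaHat, Fin.sum_univ_three, Matrix.cons_val_zero, Matrix.cons_val_one,
    Matrix.cons_val]
  rw [hdsymm 1 0, hdsymm 2 0, hdsymm 2 1, hd00]
  ring

theorem auxa_dense (d : Fin 3 → Fin 3 → ℝ) 
    (hdsymm : ∀ i j, d i j = d j i) (hd00 : d 0 0 = 0)
    (hdne : ∃ i j : Fin 3, (i, j) ≠ ((0 : Fin 3), (0 : Fin 3)) ∧ d i j ≠ 0) :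
    Dense {θ | auxa d θ ≠ 0} := by
  have he := funext (auxa_eq d hdsymm hd00)
  have hana : AnalyticOnNhd ℝ (auxa d) Set.univ := by
    rw [he]
    intro x _
    fun_prop
  intro θ
  rw [mem_closure_iff_frequently]
  intro hcon
  have hz : auxa d = fun _ => 0 := by
    apply hana.eq_of_eventuallyEq (z₀ := θ) (fun _ _ => analyticAt_const)
    filter_upwards [hcon] with x hx
    simpa using hx
  rw [he] at hz
  have e0 := congrFun hz 0
  have e1 := congrFun hz (Real.pi / 2)
  have e2 := congrFun hz Real.pi
  have e3 := congrFun hz (-(Real.pi / 2))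
  have e4 := congrFun hz (Real.pi / 4)
  simp only [Real.cos_zero, Real.sin_zero, Real.cos_pi_div_two, Real.sin_pi_div_two, Real.cos_pi,
    Real.sin_pi, Real.cos_neg, Real.sin_neg, Real.cos_pi_div_four, Real.sin_pi_div_four] 
    at e0 e1 e2 e3 e4
  have h01 : d 0 1 = 0 := by linarith
  have h11 : d 1 1 = 0 := by linarith
  have h02 : d 0 2 = 0 := by linarith
  have h22 : d 2 2 = 0 := by linarith
  have h12 : d 1 2 = 0 := by
    rw [h01, h11, h02, h22] at e4
    have h2 : Real.sqrt 2 * Real.sqrt 2 = 2 := Real.mul_self_sqrt (by norm_num)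
    linear_combination e4 - d 1 2 / 2 * h2
  obtain ⟨i, j, -, h⟩ := hdne
  apply h
  have h10 := hdsymm 1 0
  have h20 := hdsymm 2 0
  have h21 := hdsymm 2 1
  rw [h01] at h10
  rw [h02] at h20
  rw [h12] at h21
  clear hdsymm
  fin_cases i <;> fin_cases j <;> assumption

theorem aux_tendsto {α : Type*} {l : Filter α} {u w : α → ℝ} {c : ℝ} (hc : 0 < c)
    (hu : Tendsto u l (𝓝 0)) (hw : Tendsto w l (𝓝 c)) (hne : ∀ᶠ x in l, u x ≠ 0) :
    Tendsto (fun x => (1 / u x) * Real.log (1 + u x / w x)) l (𝓝 (1 / c)) := by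
  have hx : Tendsto (fun x => 1 + u x / w x) l (𝓝[≠] 1) := by
    rw [tendsto_nhdsWithin_iff]
    constructor
    · have := (hu.div hw hc.ne').const_add 1
      simpa using this
    · filter_upwards [hne, hw.eventually (lt_mem_nhds hc)] with x h1 h2
      have : u x / w x ≠ 0 := div_ne_zero h1 h2.ne'
      simpa using ⟨h1, h2.ne'⟩
  have h1 := ((Real.hasDerivAt_log one_ne_zero).tendsto_slope).comp hx
  have h2 := h1.div hw hc.ne'
  simp only [inv_one] at h2
  refine h2.congr' ?_
  filter_upwards [hne, hw.eventually (lt_mem_nhds hc)] with x h1 h2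
  simp only [Function.comp, slope_def_field, Real.log_one, Pi.div_apply]
  have := h2.ne'
  rw [add_sub_cancel_left, sub_zero]
  field_simp

theorem aux_main
    (M : ℝ) (hM : 0 < M)
    (φ0 φ1 : ℝ × ℝ → ℝ)
    (hφ0 : ContDiff ℝ (⊤ : ℕ∞) φ0) (hφ1 : ContDiff ℝ (⊤ : ℕ∞) φ1)
    (hs0 : SuppIn M φ0) (hs1 : SuppIn M φ1)
    (d : Fin 3 → Fin 3 → ℝ)
    (hdsymm : ∀ i j, d i j = d j i) (hd00 : d 0 0 = 0)
    (hdne : ∃ i j : Fin 3, (i, j) ≠ ((0 : Fin 3), (0 : Fin 3)) ∧ d i j ≠ 0)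
    (e : Fin 3 → Fin 3 → Fin 3 → ℝ) (p : ℝ × ℝ) (hp : p ∈ setD M d e φ0 φ1) :
    tau0 M d e φ0 φ1 ≤ 1 / F2 e φ0 φ1 p.1 p.2 := by
  obtain ⟨hpM, hpθ, hp1, hp2⟩ := hp
  have hF := aux_F0_smooth M hM φ0 φ1 hφ0 hφ1 hs0 hs1
  have hF' := aux_dsmooth _ hF
  have hF'' := aux_dsmooth _ hF'
  simp only at hF' hF''
  have hom : ∀ i, Continuous (fun q : ℝ × ℝ => omegaHat q.2 i) := by
    intro i
    fin_cases i <;> simp [omegaHat] <;> fun_prop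
  have hc1 : Continuous (fun q : ℝ × ℝ => F1 d φ0 φ1 q.1 q.2) := by
    unfold F1
    refine Continuous.mul ?_ hF'.continuous
    fun_prop
  have hc2 : Continuous (fun q : ℝ × ℝ => F2 e φ0 φ1 q.1 q.2) := by
    unfold F2
    refine Continuous.mul ?_ hF''.continuous
    fun_prop
  let S : Set (ℝ × ℝ) := {q | q.1 < M ∧ q.2 ∈ Set.Icc 0 (2 * Real.pi) ∧ F1 d φ0 φ1 q.1 q.2 ≠ 0}
  have hcl : p ∈ closure S := by
    have hσ : p.1 ∈ closure {σ | deriv (fun σ' => F0 φ0 φ1 σ' p.2) σ ≠ 0} := by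
      rw [mem_closure_iff_frequently]
      intro hcon
      have hev : (fun σ => deriv (fun σ' => F0 φ0 φ1 σ' p.2) σ) =ᶠ[𝓝 p.1] fun _ => 0 := by
        filter_upwards [hcon] with x hx
        simpa using hx
      have := hev.deriv_eq
      simp only [deriv_const] at this
      simp only [F2] at hp2
      rw [this] at hp2
      simp at hp2
    have hθ : Set.Icc 0 (2 * Real.pi) ⊆
        closure (Set.Ioo 0 (2 * Real.pi) ∩ {θ | auxa d θ ≠ 0}) := by
      rw [← closure_Ioo (by positivity)]
      exact closure_minimal 
        ((auxa_dense d hdsymm hd00 hdne).open_subset_closure_inter isOpen_Ioo) isClosed_closure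
    rw [_root_.mem_closure_iff]
    intro O hO hpO
    -- first move in the radial variable
    have hO1 : IsOpen {σ : ℝ | (σ, p.2) ∈ O ∧ σ < M} :=
      (hO.preimage (by fun_prop : Continuous fun σ : ℝ => (σ, p.2))).inter isOpen_Iio
    obtain ⟨σ, ⟨hσO, hσM⟩, hσg⟩ := (_root_.mem_closure_iff.mp hσ) _ hO1 ⟨hpO, hpM⟩
    have hO2 : IsOpen {θ : ℝ | (σ, θ) ∈ O ∧ deriv (fun σ' => F0 φ0 φ1 σ' θ) σ ≠ 0} := by
      refine (hO.preimage (by fun_prop : Continuous fun θ : ℝ => (σ, θ))).inter ?_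
      have : Continuous fun θ : ℝ => deriv (fun σ' => F0 φ0 φ1 σ' θ) σ :=
        Continuous.comp (g := fun q : ℝ × ℝ => deriv (fun s => F0 φ0 φ1 s q.2) q.1)
          (f := fun θ : ℝ => (σ, θ)) hF'.continuous (by fun_prop)
      exact isOpen_ne_fun this continuous_const
    obtain ⟨θ, ⟨hθO, hθg⟩, hθI, hθa⟩ := (_root_.mem_closure_iff.mp (hθ hpθ)) _ hO2 ⟨hσO, hσg⟩
    exact ⟨(σ, θ), hθO, hσM, ⟨hθI.1.le, hθI.2.le⟩, mul_ne_zero hθa hθg⟩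
  have : (𝓝[S] p).NeBot := mem_closure_iff_nhdsWithin_neBot.mp hcl
  have t1 : Tendsto (fun q : ℝ × ℝ => F1 d φ0 φ1 q.1 q.2) (𝓝[S] p) (𝓝 0) := by
    rw [← hp1]
    exact (hc1.tendsto p).mono_left nhdsWithin_le_nhds
  have t2 : Tendsto (fun q : ℝ × ℝ => F2 e φ0 φ1 q.1 q.2) (𝓝[S] p) (𝓝 (F2 e φ0 φ1 p.1 p.2)) :=
    (hc2.tendsto p).mono_left nhdsWithin_le_nhds
  have hS : ∀ᶠ q in 𝓝[S] p, q ∈ S := self_mem_nhdsWithin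
  have t3 := aux_tendsto hp2 t1 t2 (hS.mono fun q hq => hq.2.2)
  refine ge_of_tendsto t3 ?_
  have t4 : Tendsto (fun q : ℝ × ℝ => 1 + F1 d φ0 φ1 q.1 q.2 / F2 e φ0 φ1 q.1 q.2)
      (𝓝[S] p) (𝓝 1) := by
    have := (t1.div t2 hp2.ne').const_add 1
    simpa using this
  filter_upwards [hS, t2.eventually (lt_mem_nhds hp2), t4.eventually (lt_mem_nhds one_pos),
    t3.eventually (lt_mem_nhds (one_div_pos.mpr hp2))] with q h1 h2 h3 h4
  refine csInf_le ⟨0, ?_⟩ ⟨q, ⟨⟨h1.1, h1.2.1, h1.2.2, h2.ne', h3⟩, h4⟩, rfl⟩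
  rintro _ ⟨r, hr, rfl⟩
  exact hr.2.le

/-- Lemma 2.2: `inf_D 1/F₂ ≥ τ₀`, hence `min{τ₀, inf_D G̃₀} = τ₀`. -/
theorem inf_on_setD_ge_tau0
    (M : ℝ) (hM : 0 < M)
    (φ0 φ1 : ℝ × ℝ → ℝ)
    (hφ0 : ContDiff ℝ (⊤ : ℕ∞) φ0) (hφ1 : ContDiff ℝ (⊤ : ℕ∞) φ1)
    (hs0 : SuppIn M φ0) (hs1 : SuppIn M φ1)
    (d : Fin 3 → Fin 3 → ℝ)
    (hdsymm : ∀ i j, d i j = d j i) (hd00 : d 0 0 = 0)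
    (hdne : ∃ i j : Fin 3, (i, j) ≠ ((0 : Fin 3), (0 : Fin 3)) ∧ d i j ≠ 0)
    (e : Fin 3 → Fin 3 → Fin 3 → ℝ)
    (hnull : NullCondFails e)
    (hne : φ0 ≠ 0 ∨ φ1 ≠ 0)
    (hD : (setD M d e φ0 φ1).Nonempty) :
    tau0 M d e φ0 φ1 ≤
      sInf ((fun p : ℝ × ℝ => 1 / F2 e φ0 φ1 p.1 p.2) '' setD M d e φ0 φ1) ∧
    min (tau0 M d e φ0 φ1)
      (sInf ((fun p : ℝ × ℝ => 1 / F2 e φ0 φ1 p.1 p.2) '' setD M d e φ0 φ1))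
      = tau0 M d e φ0 φ1 := by
  have h : tau0 M d e φ0 φ1 ≤
      sInf ((fun p : ℝ × ℝ => 1 / F2 e φ0 φ1 p.1 p.2) '' setD M d e φ0 φ1) := by
    refine le_csInf (hD.image _) ?_
    rintro _ ⟨p, hp, rfl⟩
    exact aux_main M hM φ0 φ1 hφ0 hφ1 hs0 hs1 d hdsymm hd00 hdne e p hp
  exact ⟨h, min_eq_left h⟩
end
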